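/- Let B^{s+1}_n denote the number of decreasing maximal chains in Π_{n,s+1}, and for n ≥ 2 and 1 ≤ i ≤ s let B^{s+1,i}_n denote the number of decreasing maximal chains whose highest-edge label has middle coordinate i. Then B^{s+1,i}_n = Σ_{α=1}^{n−1} Σ_{i' ≥ i} B^{s+1,i'}_α · B^{s+1}_{n−α} · C(n−1, α−1)^i · C(n−1, α) · C(n, α)^{s−i}, where B^{s+1}_1 = 1 and for α = 1 the inner sum over i' is replaced by the single term B^{s+1}_1. -/

import Mathlib

open Finset

/-- A vector partition of `[n]` into `s+1` components: a partition `P` of `[n]`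
together with `s` labelings of its parts. -/
structure VPart (n s : ℕ) where
  P : Finpartition (Finset.univ : Finset (Fin n))
  w : Fin s → Finset (Fin n) → Finset (Fin n)
  card_w : ∀ i : Fin s, ∀ B ∈ P.parts, (w i B).card = B.card
  part_w : ∀ i : Fin s, ∀ x : Fin n, ∃! B, B ∈ P.parts ∧ x ∈ w i B
  w_junk : ∀ i B, B ∉ P.parts → w i B = ∅

namespace VPart

variable {n s : ℕ}

@[ext] theorem ext' {x y : VPart n s} (hP : x.P = y.P) (hw : x.w = y.w) : x = y := by
  cases x; cases y; simp_all

/-- componentwise union-refinement order -/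
instance : PartialOrder (VPart n s) where
  le x y := x.P ≤ y.P ∧
    ∀ i : Fin s, ∀ B ∈ x.P.parts, ∀ B' ∈ y.P.parts, B ⊆ B' → x.w i B ⊆ y.w i B'
  le_refl x := by
    refine ⟨le_refl _, fun i B hB B' hB' hBB' => ?_⟩
    obtain rfl : B = B' := by
      obtain ⟨a, ha⟩ := x.P.nonempty_of_mem_parts hB
      exact x.P.eq_of_mem_parts hB hB' ha (hBB' ha)
    exact subset_rfl
  le_trans x y z hxy hyz := by
    refine ⟨le_trans hxy.1 hyz.1, fun i B hB B'' hB'' hBB'' => ?_⟩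
    obtain ⟨B', hB', hBB'⟩ := hxy.1 hB
    obtain ⟨B''', hB''', hB'B'''⟩ := hyz.1 hB'
    obtain ⟨a, ha⟩ := x.P.nonempty_of_mem_parts hB
    obtain rfl : B''' = B'' :=
      z.P.eq_of_mem_parts hB''' hB'' (hB'B''' (hBB' ha)) (hBB'' ha)
    exact subset_trans (hxy.2 i B hB B' hB' hBB') (hyz.2 i B' hB' B''' hB''' hB'B''')
  le_antisymm x y hxy hyx := by
    have hP : x.P = y.P := le_antisymm hxy.1 hyx.1
    refine ext' hP ?_
    funext i B
    by_cases hB : B ∈ x.P.parts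
    · exact subset_antisymm (hxy.2 i B hB B (hP ▸ hB) subset_rfl)
        (hyx.2 i B (hP ▸ hB) B hB subset_rfl)
    · rw [x.w_junk i B hB, y.w_junk i B (hP ▸ hB)]

/-- the part of the underlying partition containing `k` -/
def partOf (x : VPart n s) (k : Fin n) : Finset (Fin n) := x.P.part k

/-- the atom word of `x`: `atomWord x i k` is the element of the `i`-th label of the
part containing `k` whose rank in that label matches the rank of `k` in its part. -/
def atomWord (x : VPart n s) (i : Fin s) (k : Fin n) : Fin n :=
  (((x.w i (x.partOf k)).sort (· ≤ ·)).getD (((x.partOf k).filter (· < k)).card)) k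

/-- `x` is an atom: all parts of the underlying partition are singletons. -/
def IsAtomic (x : VPart n s) : Prop := ∀ B ∈ x.P.parts, B.card = 1

/-- strict lexicographic order on atom words, with `i` as the major index
and `k` the minor index. -/
def wordLt (A B : Fin s → Fin n → Fin n) : Prop :=
  ∃ i k, A i k < B i k ∧
    ∀ i' k', (i' < i ∨ (i' = i ∧ k' < k)) → A i' k' = B i' k'

def wordLe (A B : Fin s → Fin n → Fin n) : Prop := wordLt A B ∨ A = B

end VPart

/-- labels: `ℤ × ℤ × ℤ` with the lexicographic order -/
abbrev Lbl : Type := ℤ ×ₗ ℤ ×ₗ ℤ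

def mkLbl (a b c : ℤ) : Lbl := toLex (a, toLex (b, c))

namespace VPart

variable {n s : ℕ}

set_option maxHeartbeats 1000000 in
open scoped Classical in
/-- the `(k,i,j)` label for an edge with distinct atom words (1-based) -/
noncomputable def firstDiff (x y : VPart n s) : Lbl :=
  let D : Finset (Fin n × Fin s) :=
    Finset.univ.filter fun p => atomWord x p.2 p.1 ≠ atomWord y p.2 p.1
  if h : D.Nonempty then
    have hk : (D.image Prod.fst).Nonempty := h.image _
    let k := (D.image Prod.fst).min' hk
    have hk2 : ((D.filter fun p => p.1 = k).image Prod.snd).Nonempty := by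
      obtain ⟨p, hp, hpk⟩ := Finset.mem_image.mp ((D.image Prod.fst).min'_mem hk)
      exact ⟨p.2, Finset.mem_image.mpr ⟨p, Finset.mem_filter.mpr ⟨hp, hpk⟩, rfl⟩⟩
    let i := ((D.filter fun p => p.1 = k).image Prod.snd).min' hk2
    mkLbl ((k : ℕ) + 1) ((i : ℕ) + 1) ((atomWord y i k : ℕ) + 1)
  else mkLbl 0 0 0

/-- the maximum (1-based) of the union of the two merged parts -/
noncomputable def mergeMax (x y : VPart n s) : ℤ :=
  ((y.P.parts \ x.P.parts).sup fun B => B.sup fun t => (t : ℕ) + 1 : ℕ)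

/-- the (1-based) index of an atom in the lexicographic order on atoms -/
noncomputable def atomIndex (a : VPart n s) : ℤ :=
  (Nat.card {a' : VPart n s // a'.IsAtomic ∧ wordLe (atomWord a') (atomWord a)} : ℤ)

/-- The edge labeling `λ` of `Π_{n,s+1}` (on arbitrary pairs; only its values on
covering pairs are relevant). -/
noncomputable def lam : WithBot (VPart n s) → WithBot (VPart n s) → Lbl
  | ⊥, (y : VPart n s) => mkLbl ((n : ℤ) - 1) (s + atomIndex y) 0
  | (x : VPart n s), (y : VPart n s) =>
      if atomWord x = atomWord y then mkLbl n (mergeMax x y) 0 else firstDiff x y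
  | _, _ => mkLbl 0 0 0

end VPart

open VPart

/-- decreasing maximal chains of `Π_{n,s+1}` -/
def DecChain (n s : ℕ) : Type :=
  {c : Fin (n + 1) -> WithBot (VPart n s) //
    c 0 = ⊥ ∧ IsTop (c (Fin.last n)) ∧ (∀ e : Fin n, c e.castSucc ⋖ c e.succ) ∧
      Antitone fun e : Fin n => lam (c e.castSucc) (c e.succ)}

/-- `B^{s+1}_n`: the number of decreasing maximal chains of `Π_{n,s+1}` -/
noncomputable def Bt (n s : ℕ) : ℕ := Nat.card (DecChain n s)

/-- `B^{s+1,i}_n`: the number of decreasing maximal chains of `Π_{n,s+1}` whose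
highest edge label has middle coordinate `i` -/
noncomputable def Bti (n s : ℕ) (i : ℕ) : ℕ :=
  Nat.card {c : DecChain n s //
    (ofLex ((ofLex (lam (c.1 ⟨n - 1, by omega⟩) (c.1 ⟨n, by omega⟩))).2)).1 = (i : ℤ)}


open Finset VPart

section general
open scoped Classical

set_option linter.unusedSectionVars false

variable {α Λ : Type*} [Fintype α] [PartialOrder Λ]

noncomputable def cnt (R : α → α → Prop) (L : α → α → Λ) (b : α) : ℕ → α → Λ → ℕ
  | 0, x, _ => if x = b then 1 else 0
  | r + 1, x, l => ∑ y, if R y x ∧ l ≤ L y x then cnt R L b r y (L y x) else 0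

def ChP (R : α → α → Prop) (L : α → α → Λ) (b : α) (r : ℕ) (x : α) (c : Fin (r + 1) → α) : Prop :=
  c 0 = b ∧ c (Fin.last r) = x ∧ (∀ e : Fin r, R (c e.castSucc) (c e.succ)) ∧
    Antitone fun e : Fin r => L (c e.castSucc) (c e.succ)

theorem chP_snoc (R : α → α → Prop) (L : α → α → Λ) (b : α) (r : ℕ) (x : α)
    (c : Fin (r + 2) → α) : ChP R L b (r + 1) x c ↔
      c (Fin.last (r+1)) = x ∧ R (c (Fin.last r).castSucc) x ∧
      ChP R L b r (c (Fin.last r).castSucc) (fun e => c e.castSucc) ∧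
      ∀ e : Fin r, L (c (Fin.last r).castSucc) x ≤ L (c e.castSucc.castSucc) (c e.succ.castSucc) := by
  unfold ChP
  constructor
  · rintro ⟨h0, h1, h2, h3⟩
    have hl := h2 (Fin.last r)
    rw [Fin.succ_last, h1] at hl
    refine ⟨h1, hl, ⟨h0, rfl, fun e => h2 e.castSucc, fun e f hef => ?_⟩, fun e => ?_⟩
    · exact h3 (Fin.castSucc_le_castSucc_iff.2 hef)
    · have := h3 (Fin.le_last e.castSucc)
      simp only [Fin.succ_last, h1] at this
      exact this
  · rintro ⟨h1, h2, ⟨h3, -, h4, h5⟩, h6⟩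
    refine ⟨h3, h1, fun e => ?_, fun e f hef => ?_⟩
    · induction e using Fin.lastCases with
      | last => rw [Fin.succ_last, h1]; exact h2
      | cast e => exact h4 e
    · induction f using Fin.lastCases with
      | last =>
        induction e using Fin.lastCases with
        | last => exact le_rfl
        | cast e => simp only [Fin.succ_last, h1]; exact h6 e
      | cast f =>
        induction e using Fin.lastCases with
        | last => exact absurd hef (not_le.2 (Fin.castSucc_lt_last f))
        | cast e => exact h5 (Fin.castSucc_le_castSucc_iff.1 hef)

noncomputable def fiberEquiv (R : α → α → Prop) (L : α → α → Λ) (b : α) (r : ℕ) (x : α)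
    (Q : α → Prop) (y : α) (hy : R y x ∧ Q y) :
    {c : {c : Fin (r + 2) → α // ChP R L b (r + 1) x c ∧ Q (c (Fin.last r).castSucc)} //
      c.1 (Fin.last r).castSucc = y} ≃
    {c : Fin (r + 1) → α // ChP R L b r y c ∧ ∀ e : Fin r, L y x ≤ L (c e.castSucc) (c e.succ)} where
  toFun c := ⟨fun e => c.1.1 e.castSucc, by
    obtain ⟨⟨c, hc, hq⟩, rfl⟩ := c
    have := (chP_snoc R L b r x c).1 hc
    exact ⟨this.2.2.1, this.2.2.2⟩⟩
  invFun c := ⟨⟨Fin.snoc (α := fun _ => α) c.1 x, by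
    obtain ⟨c, hc, hq⟩ := c
    have hl : c (Fin.last r) = y := hc.2.1
    rw [chP_snoc]
    simp only [Fin.snoc_castSucc, Fin.snoc_last, hl]
    exact ⟨⟨trivial, hy.1, hc, hq⟩, hy.2⟩⟩, by
    simp only [Fin.snoc_castSucc]
    exact c.2.1.2.1⟩
  left_inv c := by
    obtain ⟨⟨c, hc, hq⟩, rfl⟩ := c
    ext e
    induction e using Fin.lastCases with
    | last => simp [hc.2.1]
    | cast e => simp
  right_inv c := by
    ext e
    simp

theorem card_chains_aux (R : α → α → Prop) (L : α → α → Λ) (b : α) (r : ℕ)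
    (h : ∀ y l, Nat.card {c : Fin (r + 1) → α // ChP R L b r y c ∧
      ∀ e : Fin r, l ≤ L (c e.castSucc) (c e.succ)} = cnt R L b r y l)
    (x : α) (Q : α → Prop) :
    Nat.card {c : Fin (r + 2) → α // ChP R L b (r + 1) x c ∧ Q (c (Fin.last r).castSucc)} =
      ∑ y, if R y x ∧ Q y then cnt R L b r y (L y x) else 0 := by
  rw [← Nat.card_congr (Equiv.sigmaFiberEquiv (fun c : {c : Fin (r + 2) → α //
    ChP R L b (r + 1) x c ∧ Q (c (Fin.last r).castSucc)} => c.1 (Fin.last r).castSucc)),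
    Nat.card_sigma]
  refine Finset.sum_congr rfl fun y _ => ?_
  split_ifs with hy
  · rw [← h y (L y x)]
    exact Nat.card_congr (fiberEquiv R L b r x Q y hy)
  · rw [Nat.card_eq_zero]
    left
    refine ⟨fun c => hy ?_⟩
    obtain ⟨⟨c, hc, hq⟩, rfl⟩ := c
    exact ⟨((chP_snoc R L b r x c).1 hc).2.1, hq⟩

theorem card_chains (R : α → α → Prop) (L : α → α → Λ) (b : α) (r : ℕ) : ∀ y l,
    Nat.card {c : Fin (r + 1) → α // ChP R L b r y c ∧
      ∀ e : Fin r, l ≤ L (c e.castSucc) (c e.succ)} = cnt R L b r y l := by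
  induction r with
  | zero =>
    intro y l
    simp only [cnt]
    split_ifs with h
    · subst h
      rw [Nat.card_eq_one_iff_unique]
      refine ⟨⟨fun c d => ?_⟩, ⟨⟨fun _ => y, ⟨rfl, rfl, fun e => e.elim0, fun e => e.elim0⟩, fun e => e.elim0⟩⟩⟩
      ext e
      obtain rfl : e = 0 := Fin.eq_zero e
      rw [c.2.1.1, d.2.1.1]
    · rw [Nat.card_eq_zero]
      left
      refine ⟨fun c => h ?_⟩
      exact c.2.1.2.1.symm.trans c.2.1.1
  | succ r ih =>
    intro y l
    rw [cnt, ← card_chains_aux R L b r ih y (fun z => l ≤ L z y)]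
    refine Nat.card_congr (Equiv.subtypeEquivRight fun c => ?_)
    refine and_congr_right fun hc => ⟨fun h => ?_, fun h e => ?_⟩
    · have := h (Fin.last r)
      rwa [Fin.succ_last, hc.2.1] at this
    · have := hc.2.2.2 (Fin.le_last e)
      simp only [Fin.succ_last, hc.2.1] at this
      exact h.trans this

theorem card_chainsQ (R : α → α → Prop) (L : α → α → Λ) (b : α) (r : ℕ)
    (x : α) (Q : α → Prop) :
    Nat.card {c : Fin (r + 2) → α // ChP R L b (r + 1) x c ∧ Q (c (Fin.last r).castSucc)} =
      ∑ y, if R y x ∧ Q y then cnt R L b r y (L y x) else 0 :=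
  card_chains_aux R L b r (card_chains R L b r) x Q

end general
open Finset VPart

namespace VPart
variable {n s : ℕ}

/-- `y` is obtained from `x` by splitting the part `B` into `C` and `B \ C`. -/
structure IsSplit (x y : VPart n s) (B C : Finset (Fin n)) : Prop where
  hB : B ∈ x.P.parts
  hCB : C ⊆ B
  hne : C ≠ B
  hC : C.Nonempty
  parts : y.P.parts = insert C (insert (B \ C) (x.P.parts.erase B))
  w1 : ∀ i, y.w i C ⊆ x.w i B
  w2 : ∀ i, y.w i (B \ C) = x.w i B \ y.w i C
  w3 : ∀ i, ∀ B' ∈ x.P.parts, B' ≠ B → y.w i B' = x.w i B'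

theorem w_inj (x : VPart n s) (i : Fin s) {B B' : Finset (Fin n)} (hB : B ∈ x.P.parts)
    (hB' : B' ∈ x.P.parts) {a : Fin n} (ha : a ∈ x.w i B) (ha' : a ∈ x.w i B') : B = B' :=
  (x.part_w i a).unique ⟨hB, ha⟩ ⟨hB', ha'⟩

theorem part_mem' (x : VPart n s) (k : Fin n) : x.P.part k ∈ x.P.parts :=
  x.P.part_mem.2 (mem_univ k)

theorem mem_part' (x : VPart n s) (k : Fin n) : k ∈ x.P.part k :=
  x.P.mem_part_self.2 (mem_univ k)

theorem exists_split (x : VPart n s) {B C : Finset (Fin n)} (hB : B ∈ x.P.parts) (hCB : C ⊆ B)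
    (hne : C ≠ B) (hC : C.Nonempty) (U : Fin s → Finset (Fin n)) (hU : ∀ i, U i ⊆ x.w i B)
    (hUc : ∀ i, (U i).card = C.card) :
    ∃ y : VPart n s, IsSplit x y B C ∧ ∀ i, y.w i C = U i := by
  classical
  have hD : (B \ C).Nonempty := by
    rw [sdiff_nonempty]
    exact fun h => hne (subset_antisymm hCB h)
  have hCD : C ≠ B \ C := by
    intro h
    obtain ⟨a, ha⟩ := hC
    have h2 := ha
    rw [h] at h2
    exact (mem_sdiff.1 h2).2 ha
  have hCx : C ∉ x.P.parts := by
    intro h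
    obtain ⟨a, ha⟩ := hC
    exact hne (x.P.eq_of_mem_parts h hB ha (hCB ha))
  have hDx : B \ C ∉ x.P.parts := by
    intro h
    obtain ⟨a, ha⟩ := hD
    have := x.P.eq_of_mem_parts h hB ha (mem_sdiff.1 ha).1
    obtain ⟨c, hc⟩ := hC
    have h2 := hCB hc
    rw [← this] at h2
    exact (mem_sdiff.1 h2).2 hc
  let ps := insert C (insert (B \ C) (x.P.parts.erase B))
  have hps : ∀ {p}, p ∈ ps ↔ p = C ∨ p = B \ C ∨ (p ≠ B ∧ p ∈ x.P.parts) := by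
    intro p; simp [ps]
  let Q : Finpartition (univ : Finset (Fin n)) := Finpartition.ofExistsUnique ps
    (fun p _ => subset_univ p)
    (by
      intro a _
      by_cases haB : a ∈ B
      · by_cases haC : a ∈ C
        · refine ⟨C, ⟨hps.2 (Or.inl rfl), haC⟩, ?_⟩
          rintro p ⟨hp, hap⟩
          rcases hps.1 hp with h | h | ⟨h, h'⟩
          · exact h
          · rw [h] at hap; exact absurd haC (mem_sdiff.1 hap).2
          · exact absurd (x.P.eq_of_mem_parts h' hB hap haB) h
        · refine ⟨B \ C, ⟨hps.2 (Or.inr (Or.inl rfl)), mem_sdiff.2 ⟨haB, haC⟩⟩, ?_⟩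
          rintro p ⟨hp, hap⟩
          rcases hps.1 hp with h | h | ⟨h, h'⟩
          · rw [h] at hap; exact absurd hap haC
          · exact h
          · exact absurd (x.P.eq_of_mem_parts h' hB hap haB) h
      · refine ⟨x.P.part a, ⟨hps.2 (Or.inr (Or.inr ⟨?_, part_mem' x a⟩)), mem_part' x a⟩, ?_⟩
        · intro h; rw [← h] at haB; exact haB (mem_part' x a)
        · rintro p ⟨hp, hap⟩
          rcases hps.1 hp with h | h | ⟨h, h'⟩
          · rw [h] at hap; exact absurd (hCB hap) haB
          · rw [h] at hap; exact absurd (mem_sdiff.1 hap).1 haB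
          · exact (x.P.part_eq_of_mem h' hap).symm)
    (by
      intro h
      rcases hps.1 h with h | h | ⟨h, h'⟩
      · exact hC.ne_empty h.symm
      · exact hD.ne_empty h.symm
      · exact x.P.empty_notMem_parts h')
  have hQ : Q.parts = ps := rfl
  let W : Fin s → Finset (Fin n) → Finset (Fin n) := fun i p =>
    if p = C then U i else if p = B \ C then x.w i B \ U i else if p = B then ∅ else x.w i p
  have hW1 : ∀ i, W i C = U i := by intro i; simp [W]
  have hW2 : ∀ i, W i (B \ C) = x.w i B \ U i := by intro i; simp [W, hCD.symm]
  have hW3 : ∀ i p, p ∈ x.P.parts → p ≠ B → W i p = x.w i p := by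
    intro i p hp hpB
    have h1 : p ≠ C := fun h => hCx (h ▸ hp)
    have h2 : p ≠ B \ C := fun h => hDx (h ▸ hp)
    simp [W, h1, h2, hpB]
  refine ⟨⟨Q, W, ?_, ?_, ?_⟩, ⟨hB, hCB, hne, hC, hQ, ?_, ?_, hW3⟩, hW1⟩
  · intro i p hp
    rw [hQ] at hp
    rcases hps.1 hp with h | h | ⟨h, h'⟩
    · rw [h, hW1, hUc]
    · rw [h, hW2, card_sdiff_of_subset (hU i), card_sdiff_of_subset hCB, hUc, x.card_w i B hB]
    · rw [hW3 i p h' h, x.card_w i p h']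
  · intro i a
    rw [hQ]
    obtain ⟨E, ⟨hE, haE⟩, hE2⟩ := x.part_w i a
    by_cases hEB : E = B
    · subst hEB
      by_cases haU : a ∈ U i
      · refine ⟨C, ⟨hps.2 (Or.inl rfl), by rwa [hW1]⟩, ?_⟩
        rintro p ⟨hp, hap⟩
        rcases hps.1 hp with h | h | ⟨h, h'⟩
        · exact h
        · rw [h, hW2] at hap; exact absurd haU (mem_sdiff.1 hap).2
        · rw [hW3 i p h' h] at hap
          exact absurd (hE2 p ⟨h', hap⟩) h
      · refine ⟨E \ C, ⟨hps.2 (Or.inr (Or.inl rfl)), ?_⟩, ?_⟩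
        · rw [hW2]; exact mem_sdiff.2 ⟨haE, haU⟩
        rintro p ⟨hp, hap⟩
        rcases hps.1 hp with h | h | ⟨h, h'⟩
        · rw [h, hW1] at hap; exact absurd hap haU
        · exact h
        · rw [hW3 i p h' h] at hap
          exact absurd (hE2 p ⟨h', hap⟩) h
    · refine ⟨E, ⟨hps.2 (Or.inr (Or.inr ⟨hEB, hE⟩)), by rwa [hW3 i E hE hEB]⟩, ?_⟩
      rintro p ⟨hp, hap⟩
      rcases hps.1 hp with h | h | ⟨h, h'⟩
      · rw [h, hW1] at hap
        exact absurd (hE2 B ⟨hB, hU i hap⟩).symm hEB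
      · rw [h, hW2] at hap
        exact absurd (hE2 B ⟨hB, (mem_sdiff.1 hap).1⟩).symm hEB
      · rw [hW3 i p h' h] at hap
        exact hE2 p ⟨h', hap⟩
  · intro i p hp
    rw [hQ, hps] at hp
    push Not at hp
    obtain ⟨h1, h2, h3⟩ := hp
    simp only [W, h1, h2, if_false]
    split_ifs with h4
    · rfl
    · exact x.w_junk i p (h3 h4)
  · intro i
    change W i C ⊆ _
    rw [hW1]; exact hU i
  · intro i
    change W i (B \ C) = x.w i B \ W i C
    rw [hW1, hW2]

namespace IsSplit

variable {x y : VPart n s} {B C : Finset (Fin n)}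

theorem mem_parts (h : IsSplit x y B C) {p : Finset (Fin n)} :
    p ∈ y.P.parts ↔ p = C ∨ p = B \ C ∨ (p ≠ B ∧ p ∈ x.P.parts) := by
  rw [h.parts]; simp

theorem sdiff_nonempty (h : IsSplit x y B C) : (B \ C).Nonempty := by
  rw [Finset.sdiff_nonempty]
  exact fun h' => h.hne (subset_antisymm h.hCB h')

theorem C_ne (h : IsSplit x y B C) : C ≠ B \ C := by
  intro h'
  obtain ⟨a, ha⟩ := h.hC
  have h2 := ha
  rw [h'] at h2
  exact (mem_sdiff.1 h2).2 ha

theorem C_notMem (h : IsSplit x y B C) : C ∉ x.P.parts := by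
  intro h'
  obtain ⟨a, ha⟩ := h.hC
  exact h.hne (x.P.eq_of_mem_parts h' h.hB ha (h.hCB ha))

theorem D_notMem (h : IsSplit x y B C) : B \ C ∉ x.P.parts := by
  intro h'
  obtain ⟨a, ha⟩ := h.sdiff_nonempty
  have := x.P.eq_of_mem_parts h' h.hB ha (mem_sdiff.1 ha).1
  obtain ⟨c, hc⟩ := h.hC
  have h2 := h.hCB hc
  rw [← this] at h2
  exact (mem_sdiff.1 h2).2 hc

theorem C_mem (h : IsSplit x y B C) : C ∈ y.P.parts := h.mem_parts.2 (Or.inl rfl)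

theorem erase_C (h : IsSplit x y B C) :
    y.P.parts.erase C = insert (B \ C) (x.P.parts.erase B) := by
  rw [h.parts, erase_insert]
  rw [mem_insert, mem_erase]
  rintro (h' | ⟨-, h'⟩)
  · exact h.C_ne h'
  · exact h.C_notMem h'

theorem card_parts (h : IsSplit x y B C) : #y.P.parts = #x.P.parts + 1 := by
  have h1 : #(y.P.parts.erase C) + 1 = #y.P.parts := card_erase_add_one h.C_mem
  rw [h.erase_C, card_insert_of_notMem, card_erase_add_one h.hB] at h1
  · exact h1.symm
  · exact fun h' => h.D_notMem (mem_of_mem_erase h')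

theorem le (h : IsSplit x y B C) : y ≤ x := by
  refine ⟨fun p hp => ?_, fun i p hp q hq hpq => ?_⟩
  · rcases h.mem_parts.1 hp with rfl | rfl | ⟨h1, h2⟩
    · exact ⟨B, h.hB, h.hCB⟩
    · exact ⟨B, h.hB, sdiff_subset⟩
    · exact ⟨p, h2, le_rfl⟩
  · obtain ⟨a, ha⟩ := y.P.nonempty_of_mem_parts hp
    rcases h.mem_parts.1 hp with rfl | rfl | ⟨h1, h2⟩
    · obtain rfl := x.P.eq_of_mem_parts h.hB hq (h.hCB ha) (hpq ha)
      exact h.w1 i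
    · obtain rfl := x.P.eq_of_mem_parts h.hB hq (mem_sdiff.1 ha).1 (hpq ha)
      rw [h.w2]; exact sdiff_subset
    · obtain rfl := x.P.eq_of_mem_parts h2 hq ha (hpq ha)
      rw [h.w3 i p h2 h1]

theorem ext_of {z : VPart n s} (h : IsSplit x y B C) (h' : IsSplit x z B C)
    (hw : ∀ i, y.w i C = z.w i C) : y = z := by
  have hP : y.P = z.P := Finpartition.ext (h.parts.trans h'.parts.symm)
  refine ext' hP ?_
  funext i p
  by_cases hp : p ∈ y.P.parts
  · rcases h.mem_parts.1 hp with rfl | rfl | ⟨h1, h2⟩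
    · exact hw i
    · rw [h.w2, h'.w2, hw]
    · rw [h.w3 i p h2 h1, h'.w3 i p h2 h1]
  · rw [y.w_junk i p hp, z.w_junk i p (hP ▸ hp)]

end IsSplit

theorem card_parts_lt {x y : VPart n s} (h : x < y) : #y.P.parts < #x.P.parts := by
  refine lt_of_le_of_ne (Finpartition.card_mono h.le.1) fun hc => h.ne ?_
  have hex : ∀ b ∈ y.P.parts, ∃ c ∈ x.P.parts, c ≤ b :=
    fun b hb => Finpartition.exists_le_of_le h.le.1 hb
  choose! f hf hfb using hex
  have hinj : Set.InjOn f y.P.parts := by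
    intro a ha b hb hab
    obtain ⟨t, ht⟩ := x.P.nonempty_of_mem_parts (hf a ha)
    exact y.P.eq_of_mem_parts ha hb (hfb a ha ht) (hfb b hb (hab ▸ ht))
  have himg : y.P.parts.image f = x.P.parts := by
    apply eq_of_subset_of_card_le
    · intro p hp
      obtain ⟨b, hb, rfl⟩ := mem_image.1 hp
      exact hf b hb
    · rw [card_image_of_injOn hinj, hc]
  have hfix : ∀ b ∈ y.P.parts, f b = b := by
    intro b hb
    refine subset_antisymm (hfb b hb) fun a ha => ?_
    have h1 := part_mem' x a
    rw [← himg] at h1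
    obtain ⟨b', hb', hbe⟩ := mem_image.1 h1
    have h2 : a ∈ f b' := hbe ▸ mem_part' x a
    obtain rfl := y.P.eq_of_mem_parts hb hb' ha (hfb b' hb' h2)
    exact h2
  have hP : x.P = y.P := by
    apply Finpartition.ext
    rw [← himg]
    ext p
    rw [mem_image]
    constructor
    · rintro ⟨b, hb, rfl⟩
      rwa [hfix b hb]
    · exact fun hp => ⟨p, hp, hfix p hp⟩
  refine ext' hP ?_
  funext i p
  by_cases hp : p ∈ x.P.parts
  · have hp' : p ∈ y.P.parts := hP ▸ hp
    refine eq_of_subset_of_card_le (h.le.2 i p hp p hp' subset_rfl) ?_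
    rw [x.card_w i p hp, y.card_w i p hp']
  · rw [x.w_junk i p hp, y.w_junk i p (hP ▸ hp)]

theorem IsSplit.covBy {x y : VPart n s} {B C : Finset (Fin n)} (h : IsSplit x y B C) : y ⋖ x := by
  have hc := h.card_parts
  refine ⟨lt_of_le_of_ne h.le ?_, fun z h1 h2 => ?_⟩
  · rintro rfl
    omega
  · have := card_parts_lt h1
    have := card_parts_lt h2
    omega

theorem exists_isSplit_of_covBy {x y : VPart n s} (h : y ⋖ x) :
    ∃ B k, k ∈ B ∧ (∀ a ∈ B, k ≤ a) ∧ IsSplit x y B (y.P.part k) := by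
  have hlt := card_parts_lt h.lt
  obtain ⟨B, hB, hBy⟩ : ∃ B ∈ x.P.parts, B ∉ y.P.parts := by
    by_contra! hcon
    have : y.P.parts ⊆ x.P.parts := by
      intro p hp
      obtain ⟨a, ha⟩ := y.P.nonempty_of_mem_parts hp
      have := hcon _ (part_mem' x a)
      rw [y.P.eq_of_mem_parts hp this ha (mem_part' x a)]
      exact part_mem' x a
    exact absurd (card_le_card this) (by omega)
  have hne := x.P.nonempty_of_mem_parts hB
  set k := B.min' hne with hk
  have hkB : k ∈ B := B.min'_mem hne
  set C := y.P.part k with hCdef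
  have hCy : C ∈ y.P.parts := part_mem' y k
  have hkC : k ∈ C := mem_part' y k
  have hCB : C ⊆ B := by
    obtain ⟨B', hB', hs⟩ := h.lt.le.1 hCy
    rwa [x.P.eq_of_mem_parts hB hB' hkB (hs hkC)]
  have hCne : C ≠ B := fun h' => hBy (h' ▸ hCy)
  obtain ⟨z, hz, hzw⟩ := exists_split x hB hCB hCne ⟨k, hkC⟩ (fun i => y.w i C)
    (fun i => h.lt.le.2 i C hCy B hB hCB) (fun i => y.card_w i C hCy)
  refine ⟨B, k, hkB, fun a ha => B.min'_le a ha, ?_⟩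
  have hyz : y ≤ z := by
    have key : ∀ p ∈ y.P.parts, ∃ q ∈ z.P.parts, p ⊆ q ∧ ∀ i, y.w i p ⊆ z.w i q := by
      intro p hp
      obtain ⟨E, hE, hpE⟩ := h.lt.le.1 hp
      by_cases hEB : E = B
      · by_cases hpC : p = C
        · exact ⟨C, hz.C_mem, hpC.le, fun i => by rw [hpC, hzw]⟩
        · refine ⟨B \ C, hz.mem_parts.2 (Or.inr (Or.inl rfl)), ?_, ?_⟩
          · intro a ha
            refine mem_sdiff.2 ⟨hEB ▸ hpE ha, fun haC => hpC ?_⟩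
            exact y.P.eq_of_mem_parts hp hCy ha haC
          · intro i a ha
            rw [hz.w2, hzw]
            refine mem_sdiff.2 ⟨?_, fun haC => hpC (w_inj y i hp hCy ha haC)⟩
            rw [← hEB]
            exact h.lt.le.2 i p hp E hE hpE ha
      · refine ⟨E, hz.mem_parts.2 (Or.inr (Or.inr ⟨hEB, hE⟩)), hpE, fun i => ?_⟩
        rw [hz.w3 i E hE hEB]
        exact h.lt.le.2 i p hp E hE hpE
    refine ⟨fun p hp => ?_, fun i p hp q hq hpq => ?_⟩
    · obtain ⟨q, hq, h1, -⟩ := key p hp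
      exact ⟨q, hq, h1⟩
    · obtain ⟨q', hq', h1, h2⟩ := key p hp
      obtain ⟨a, ha⟩ := y.P.nonempty_of_mem_parts hp
      obtain rfl := z.P.eq_of_mem_parts hq hq' (hpq ha) (h1 ha)
      exact h2 i
  have : y = z := by
    by_contra hyne
    exact h.2 (lt_of_le_of_ne hyz hyne) hz.covBy.lt
  rw [this]
  rwa [hCdef, this] at hz

/-! ### atom words -/

theorem aw_out {x y : VPart n s} {B C : Finset (Fin n)} (h : IsSplit x y B C) {k : Fin n}
    (hk : k ∉ B) (i : Fin s) : atomWord y i k = atomWord x i k := by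
  have hE : x.P.part k ≠ B := fun h' => hk (h' ▸ mem_part' x k)
  have hEy : x.P.part k ∈ y.P.parts := h.mem_parts.2 (Or.inr (Or.inr ⟨hE, part_mem' x k⟩))
  have : y.P.part k = x.P.part k := y.P.part_eq_of_mem hEy (mem_part' x k)
  unfold atomWord partOf
  rw [this, h.w3 i _ (part_mem' x k) hE]

theorem aw_least (x : VPart n s) {B : Finset (Fin n)} (hB : B ∈ x.P.parts) {k : Fin n}
    (hk : k ∈ B) (hmin : ∀ a ∈ B, k ≤ a) (i : Fin s) :
    IsLeast (x.w i B : Set (Fin n)) (atomWord x i k) := by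
  have hp : x.P.part k = B := x.P.part_eq_of_mem hB hk
  have hcard := x.card_w i B hB
  have hpos : 0 < #B := card_pos.2 ⟨k, hk⟩
  have hne : (x.w i B).Nonempty := card_pos.1 (by omega)
  unfold atomWord partOf
  rw [hp]
  have : B.filter (· < k) = ∅ := by
    rw [filter_eq_empty_iff]
    exact fun a ha => not_lt.2 (hmin a ha)
  rw [this, card_empty]
  have hl : 0 < ((x.w i B).sort (· ≤ ·)).length := by rw [length_sort]; omega
  rw [List.getD_eq_getElem _ _ hl, sorted_zero_eq_min']
  exact isLeast_min' _ hne

theorem aw_single {x y : VPart n s} {B : Finset (Fin n)} {k : Fin n} (h : IsSplit x y B {k})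
    (hmin : ∀ a ∈ B, k ≤ a) (he : ∀ i, atomWord y i k = atomWord x i k) :
    atomWord y = atomWord x := by
  funext i k'
  by_cases hk' : k' ∈ B
  · by_cases hkk : k' = k
    · rw [hkk]; exact he i
    have hkB : k ∈ B := h.hCB (mem_singleton_self k)
    have hxl := aw_least x h.hB hkB hmin i
    have hyl := aw_least y h.C_mem (mem_singleton_self k) (by simp) i
    rw [he i] at hyl
    set a := atomWord x i k with ha
    have hya : y.w i {k} = {a} := by
      have hc := y.card_w i _ h.C_mem
      rw [card_singleton, card_eq_one] at hc
      obtain ⟨b, hb⟩ := hc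
      rw [hb] at hyl ⊢
      have := hyl.1
      simp only [coe_singleton, Set.mem_singleton_iff] at this
      rw [this]
    have hx : x.P.part k' = B := x.P.part_eq_of_mem h.hB hk'
    have hy : y.P.part k' = B \ {k} := y.P.part_eq_of_mem
      (h.mem_parts.2 (Or.inr (Or.inl rfl))) (mem_sdiff.2 ⟨hk', by simpa using hkk⟩)
    unfold atomWord partOf
    rw [hx, hy, h.w2, hya]
    have hf : B.filter (· < k') = insert k ((B \ {k}).filter (· < k')) := by
      ext t
      simp only [mem_filter, mem_insert, mem_sdiff, mem_singleton]
      constructor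
      · rintro ⟨h1, h2⟩
        by_cases ht : t = k
        · exact Or.inl ht
        · exact Or.inr ⟨⟨h1, ht⟩, h2⟩
      · rintro (rfl | ⟨⟨h1, h2⟩, h3⟩)
        · exact ⟨hkB, lt_of_le_of_ne (hmin _ hk') (Ne.symm hkk)⟩
        · exact ⟨h1, h3⟩
    rw [hf, card_insert_of_notMem (by simp)]
    have hw : x.w i B = insert a (x.w i B \ {a}) := by
      ext t
      simp only [mem_insert, mem_sdiff, mem_singleton]
      constructor
      · intro h1
        by_cases ht : t = a
        · exact Or.inl ht
        · exact Or.inr ⟨h1, ht⟩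
      · rintro (rfl | ⟨h1, h2⟩)
        · exact hxl.1
        · exact h1
    conv_rhs => rw [hw]
    rw [sort_insert _ (fun b hb => hxl.2 (mem_sdiff.1 hb).1) (by simp)]
    rw [List.getD_cons_succ]
  · exact aw_out h hk' i

end VPart
open Finset VPart

theorem mkLbl_le {a b c a' b' c' : ℤ} : mkLbl a b c ≤ mkLbl a' b' c' ↔
    a < a' ∨ a = a' ∧ (b < b' ∨ b = b' ∧ c ≤ c') := by
  unfold mkLbl
  rw [Prod.Lex.toLex_le_toLex, Prod.Lex.toLex_le_toLex]

theorem mkLbl_inj {a b c a' b' c' : ℤ} : mkLbl a b c = mkLbl a' b' c' ↔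
    a = a' ∧ b = b' ∧ c = c' := by
  unfold mkLbl
  simp

def lfst (l : Lbl) : ℤ := (ofLex l).1

@[simp] theorem lfst_mk (a b c : ℤ) : lfst (mkLbl a b c) = a := rfl

theorem lfst_mono {l l' : Lbl} (h : l ≤ l') : lfst l ≤ lfst l' := by
  rcases Prod.Lex.le_iff.1 h with h | h
  · exact h.le
  · exact h.1.le

namespace VPart
variable {n s : ℕ}

noncomputable instance instFintypeVPart : Fintype (VPart n s) :=
  Fintype.ofInjective (fun x : VPart n s => (x.P, x.w)) (by
    intro x y h
    simp only [Prod.mk.injEq] at h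
    exact ext' h.1 h.2)

theorem sum_withBot (f : WithBot (VPart n s) → ℕ) :
    ∑ y, f y = f ⊥ + ∑ y : VPart n s, f y := Fintype.sum_option f

theorem lam_coe (x y : VPart n s) : lam (x : WithBot (VPart n s)) y =
    if atomWord x = atomWord y then mkLbl n (mergeMax x y) 0 else firstDiff x y := rfl

theorem lam_bot (y : VPart n s) : lam (⊥ : WithBot (VPart n s)) y =
    mkLbl ((n : ℤ) - 1) (s + atomIndex y) 0 := rfl

/-- the label shape -/
noncomputable def lblK (x : VPart n s) (k : Fin n) (i : Fin s) : Lbl :=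
  mkLbl ((k : ℕ) + 1) ((i : ℕ) + 1) ((atomWord x i k : ℕ) + 1)

theorem lblK_inj {x : VPart n s} {k k' : Fin n} {i i' : Fin s} (h : lblK x k i = lblK x k' i') :
    k = k' ∧ i = i' := by
  unfold lblK at h
  rw [mkLbl_inj] at h
  refine ⟨Fin.ext ?_, Fin.ext ?_⟩ <;> omega

set_option maxHeartbeats 1000000 in
open scoped Classical in
theorem firstDiff_spec {x y : VPart n s} (h : atomWord x ≠ atomWord y) :
    ∃ k i, firstDiff x y = lblK y k i ∧ atomWord x i k ≠ atomWord y i k ∧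
      (∀ k' < k, ∀ i', atomWord x i' k' = atomWord y i' k') ∧
      (∀ i' < i, atomWord x i' k = atomWord y i' k) := by
  have hD : (Finset.univ.filter fun p : Fin n × Fin s =>
      atomWord x p.2 p.1 ≠ atomWord y p.2 p.1).Nonempty := by
    by_contra hcon
    rw [not_nonempty_iff_eq_empty, filter_eq_empty_iff] at hcon
    apply h
    funext i k
    simpa using hcon (mem_univ (k, i))
  unfold firstDiff
  rw [dif_pos hD]
  generalize_proofs hk hk2
  refine ⟨_, _, rfl, ?_, ?_, ?_⟩
  · obtain ⟨p, hp, hpi⟩ := Finset.mem_image.mp (min'_mem _ (hk2 hk))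
    rw [mem_filter] at hp
    have h1 := (mem_filter.1 hp.1).2
    rw [hpi, hp.2] at h1
    exact h1
  · intro k' hk' i'
    by_contra hne
    refine absurd hk' (not_lt.2 (min'_le _ k' ?_))
    exact mem_image.2 ⟨(k', i'), mem_filter.2 ⟨mem_univ _, hne⟩, rfl⟩
  · intro i' hi'
    by_contra hne
    refine absurd hi' (not_lt.2 (min'_le _ i' ?_))
    exact mem_image.2 ⟨(_, i'), mem_filter.2 ⟨mem_filter.2 ⟨mem_univ _, hne⟩, rfl⟩, rfl⟩

/-- number of decreasing chains below `x` with all labels `≥ l` -/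
noncomputable def cv (n s : ℕ) (r : ℕ) (x : WithBot (VPart n s)) (l : Lbl) : ℕ :=
  cnt (fun a b : WithBot (VPart n s) => a ⋖ b) lam ⊥ r x l

open scoped Classical in
theorem cv_succ (r : ℕ) (x : VPart n s) (l : Lbl) : cv n s (r + 1) x l =
    (if (⊥ : WithBot (VPart n s)) ⋖ x ∧ l ≤ lam (⊥ : WithBot (VPart n s)) x
      then cv n s r ⊥ (lam (⊥ : WithBot (VPart n s)) x) else 0) +
    ∑ y : VPart n s, if y ⋖ x ∧ l ≤ lam (y : WithBot (VPart n s)) x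
      then cv n s r y (lam (y : WithBot (VPart n s)) x) else 0 := by
  unfold cv
  rw [cnt, sum_withBot]
  simp only [WithBot.coe_covBy_coe]
  congr!

theorem cv_zero_of_ge (r : ℕ) : ∀ (x : VPart n s) (l : Lbl), (n : ℤ) ≤ lfst l →
    cv n s r x l = 0 := by
  induction r with
  | zero => intro x l _; simp [cv, cnt]
  | succ r ih =>
    intro x l hl
    rw [cv_succ, if_neg, zero_add]
    · refine sum_eq_zero fun y _ => ?_
      split_ifs with h
      · exact ih y _ (hl.trans (lfst_mono h.2))
      · rfl
    · rintro ⟨-, h⟩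
      have := lfst_mono h
      rw [lam_bot, lfst_mk] at this
      omega

theorem card_parts_eq_of_atomic {x : VPart n s} (h : x.IsAtomic) : #x.P.parts = n := by
  have := x.P.sum_card_parts
  rw [sum_congr rfl h] at this
  simpa using this

theorem bot_covBy_iff {x : VPart n s} : (⊥ : WithBot (VPart n s)) ⋖ x ↔ x.IsAtomic := by
  rw [WithBot.bot_covBy_coe]
  constructor
  · intro h B hB
    by_contra hc
    obtain ⟨a, ha⟩ := x.P.nonempty_of_mem_parts hB
    have hne : ∀ i, (x.w i B).Nonempty := fun i => by
      rw [← card_pos, x.card_w i B hB, card_pos]; exact ⟨a, ha⟩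
    choose u hu using hne
    obtain ⟨y, hy, -⟩ := exists_split x hB (singleton_subset_iff.2 ha)
      (fun h' => hc (by rw [← h', card_singleton])) (singleton_nonempty a) (fun i => {u i})
      (fun i => singleton_subset_iff.2 (hu i)) (fun i => by simp)
    exact absurd (h hy.covBy.le) (not_le_of_gt hy.covBy.lt)
  · intro h y hy
    rcases hy.eq_or_lt with rfl | hlt
    · exact le_rfl
    · have h1 := card_parts_lt hlt
      have h2 := y.P.card_parts_le_card
      rw [card_parts_eq_of_atomic h] at h1
      simp at h2
      omega

theorem cv_zero_aux (r : ℕ)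
    (ih : ∀ (x : VPart n s) (B : Finset (Fin n)) (k : Fin n) (l : Lbl), B ∈ x.P.parts → 2 ≤ #B →
      k ∈ B → (∀ a ∈ B, k ≤ a) → ((k : ℕ) : ℤ) + 1 < lfst l → cv n s r x l = 0)
    (x y : VPart n s) (hxy : y ⋖ x) (B : Finset (Fin n)) (k : Fin n) (hB : B ∈ x.P.parts)
    (hc : 2 ≤ #B) (hk : k ∈ B) (hmin : ∀ a ∈ B, k ≤ a)
    (hl : ((k : ℕ) : ℤ) + 1 < lfst (lam (y : WithBot (VPart n s)) x)) :
    cv n s r y (lam (y : WithBot (VPart n s)) x) = 0 := by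
  obtain ⟨B', k', hk', hmin', hs⟩ := exists_isSplit_of_covBy hxy
  by_cases hBB : B' = B
  · subst hBB
    obtain rfl : k' = k := le_antisymm (hmin' k hk) (hmin k' hk')
    by_cases hC : 2 ≤ #(y.P.part k')
    · exact ih y _ k' _ hs.C_mem hC (mem_part' y k') (fun a ha => hmin a (hs.hCB ha)) hl
    · have hCe : y.P.part k' = {k'} := by
        have h1 : 0 < #(y.P.part k') := card_pos.2 ⟨k', mem_part' y k'⟩
        obtain ⟨b, hb⟩ := card_eq_one.1 (show #(y.P.part k') = 1 by omega)
        have := mem_part' y k'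
        rw [hb, mem_singleton] at this
        rw [hb, this]
      rw [hCe] at hs
      apply cv_zero_of_ge
      rw [lam_coe] at hl ⊢
      split_ifs at hl ⊢ with haw
      · simp
      · exfalso
        obtain ⟨k2, i, h1, h2, h3, h4⟩ := firstDiff_spec haw
        rw [h1, lblK, lfst_mk] at hl
        exact haw (aw_single hs hmin (fun i => h3 k' (Fin.lt_def.2 (by omega)) i))
  · exact ih y B k _ (hs.mem_parts.2 (Or.inr (Or.inr ⟨Ne.symm hBB, hB⟩))) hc hk hmin hl

theorem cv_zero_M (r : ℕ) :
    ∀ (x : VPart n s) (B : Finset (Fin n)) (k : Fin n) (l : Lbl), B ∈ x.P.parts → 2 ≤ #B →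
      k ∈ B → (∀ a ∈ B, k ≤ a) → ((k : ℕ) : ℤ) + 1 < lfst l → cv n s r x l = 0 := by
  induction r with
  | zero => intros; simp [cv, cnt]
  | succ r ih =>
    intro x B k l hB hc hk hmin hl
    rw [cv_succ, if_neg, zero_add]
    · refine sum_eq_zero fun y _ => ?_
      split_ifs with h
      · exact cv_zero_aux r ih x y h.1 B k hB hc hk hmin (hl.trans_le (lfst_mono h.2))
      · rfl
    · rintro ⟨h, -⟩
      have := bot_covBy_iff.1 h B hB
      omega

/-- `k` is the first element in a non-singleton part -/
structure FirstNS (x : VPart n s) (k : Fin n) : Prop where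
  two : 2 ≤ #(x.P.part k)
  one : ∀ k' < k, #(x.P.part k') = 1

theorem FirstNS.least {x : VPart n s} {k : Fin n} (h : FirstNS x k) :
    ∀ a ∈ x.P.part k, k ≤ a := by
  intro a ha
  by_contra hlt
  have h1 := h.one a (not_le.1 hlt)
  rw [x.P.part_eq_of_mem (part_mem' x k) ha] at h1
  have := h.two
  omega

theorem exists_firstNS {x : VPart n s} (h : ¬ x.IsAtomic) : ∃ k, FirstNS x k := by
  classical
  have hne : (univ.filter fun k => #(x.P.part k) ≠ 1).Nonempty := by
    by_contra hcon
    rw [not_nonempty_iff_eq_empty, filter_eq_empty_iff] at hcon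
    apply h
    intro B hB
    obtain ⟨a, ha⟩ := x.P.nonempty_of_mem_parts hB
    have := hcon (mem_univ a)
    rw [x.P.part_eq_of_mem hB ha] at this
    simpa using this
  refine ⟨(univ.filter fun k => #(x.P.part k) ≠ 1).min' hne, ?_, ?_⟩
  · have h1 := (mem_filter.1 (min'_mem _ hne)).2
    have h2 : 0 < #(x.P.part ((univ.filter fun k => #(x.P.part k) ≠ 1).min' hne)) :=
      card_pos.2 ⟨_, mem_part' x _⟩
    omega
  · intro k' hk'
    by_contra hne'
    exact absurd hk' (not_lt.2 (min'_le _ k' (mem_filter.2 ⟨mem_univ _, hne'⟩)))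

theorem FirstNS.not_atomic {x : VPart n s} {k : Fin n} (h : FirstNS x k) : ¬ x.IsAtomic := by
  intro h'
  have := h' _ (part_mem' x k)
  have := h.two
  omega

theorem FirstNS.dichotomy {x y : VPart n s} {k : Fin n} (h : FirstNS x k) (hxy : y ⋖ x) (r : ℕ) :
    cv n s r y (lam (y : WithBot (VPart n s)) x) = 0 ∨
      ∃ i, lam (y : WithBot (VPart n s)) x = lblK x k i := by
  obtain ⟨B, k1, hk1, hmin, hs⟩ := exists_isSplit_of_covBy hxy
  by_cases haw : atomWord y = atomWord x
  · left
    apply cv_zero_of_ge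
    rw [lam_coe, if_pos haw]
    simp
  · obtain ⟨k2, i, h1, h2, h3, h4⟩ := firstDiff_spec haw
    have hlam : lam (y : WithBot (VPart n s)) x = lblK x k2 i := by
      rw [lam_coe, if_neg haw, h1]
    have hk2 : k2 ∈ B := by
      by_contra hcon
      exact h2 (aw_out hs hcon i)
    rcases lt_trichotomy k2 k with hlt | rfl | hgt
    · exfalso
      have h5 := h.one k2 hlt
      rw [x.P.part_eq_of_mem hs.hB hk2] at h5
      have h6 := card_lt_card (ssubset_of_subset_of_ne hs.hCB hs.hne)
      have h7 := card_pos.2 hs.hC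
      omega
    · exact Or.inr ⟨i, hlam⟩
    · left
      refine cv_zero_aux r (cv_zero_M r) x y hxy _ k (part_mem' x k) h.two (mem_part' x k)
        h.least ?_
      rw [hlam, lblK, lfst_mk]
      have := Fin.lt_def.1 hgt
      omega

open scoped Classical in
/-- contribution of label `i` -/
noncomputable def Ev (r : ℕ) (x : VPart n s) (k : Fin n) (i : Fin s) : ℕ :=
  ∑ y ∈ univ.filter (fun y : VPart n s => y ⋖ x ∧ lam (y : WithBot (VPart n s)) x = lblK x k i),
    cv n s r y (lblK x k i)

open scoped Classical in
theorem FirstNS.sum_Q {x : VPart n s} {k : Fin n} (h : FirstNS x k) (r : ℕ) (Q : Lbl → Prop) :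
    (∑ y : VPart n s, if y ⋖ x ∧ Q (lam (y : WithBot (VPart n s)) x)
      then cv n s r y (lam (y : WithBot (VPart n s)) x) else 0) =
    ∑ i : Fin s, if Q (lblK x k i) then Ev r x k i else 0 := by
  have hR : ∀ i : Fin s, (if Q (lblK x k i) then Ev r x k i else 0) =
      ∑ y : VPart n s, if y ⋖ x ∧ lam (y : WithBot (VPart n s)) x = lblK x k i ∧ Q (lblK x k i)
        then cv n s r y (lblK x k i) else 0 := by
    intro i
    unfold Ev
    rw [sum_filter]
    split_ifs with hq <;> simp [hq]
  rw [sum_congr rfl (fun i _ => hR i), sum_comm]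
  refine sum_congr rfl fun y _ => ?_
  by_cases hxy : y ⋖ x
  · by_cases hex : ∃ i, lam (y : WithBot (VPart n s)) x = lblK x k i
    · obtain ⟨i, hi⟩ := hex
      rw [sum_eq_single i]
      · simp [hxy, hi]
      · intro j _ hj
        rw [if_neg]
        rintro ⟨-, h2, -⟩
        exact hj (lblK_inj (h2.symm.trans hi)).2
      · simp
    · have h0 := (h.dichotomy hxy r).resolve_right hex
      rw [h0, ite_self, sum_eq_zero]
      intro i _
      rw [if_neg]
      rintro ⟨-, h2, -⟩
      exact hex ⟨i, h2⟩
  · simp [hxy]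

end VPart
open Finset VPart

/-- numerical solution of the recursion -/
noncomputable def gF (s : ℕ) (m i : ℕ) : ℕ :=
  if m ≤ 1 then 1 else
    ∑ i' ∈ Icc i s, ∑ α ∈ (Icc 1 (m - 1)).attach,
      gF s α.1 i' * gF s (m - α.1) 1 * (m - 1).choose (α.1 - 1) ^ i' * (m - 1).choose α.1 *
        m.choose α.1 ^ (s - i')
termination_by m
decreasing_by
  · have := mem_Icc.1 α.2; omega
  · have := mem_Icc.1 α.2; omega

noncomputable def bF (s : ℕ) (m i : ℕ) : ℕ :=
  ∑ α ∈ Icc 1 (m - 1),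
      gF s α i * gF s (m - α) 1 * (m - 1).choose (α - 1) ^ i * (m - 1).choose α *
        m.choose α ^ (s - i)

theorem gF_one (s i : ℕ) : gF s 1 i = 1 := by
  rw [gF, if_pos le_rfl]

theorem gF_two (s : ℕ) {m : ℕ} (i : ℕ) (hm : 2 ≤ m) : gF s m i = ∑ i' ∈ Icc i s, bF s m i' := by
  rw [gF, if_neg (by omega)]
  refine sum_congr rfl fun i' _ => ?_
  unfold bF
  exact sum_attach (Icc 1 (m - 1)) (fun α => gF s α i' * gF s (m - α) 1 *
    (m - 1).choose (α - 1) ^ i' * (m - 1).choose α * m.choose α ^ (s - i'))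

theorem card_filter_notMem {n : ℕ} (W : Finset (Fin n)) (a : Fin n) (ha : a ∈ W) (α : ℕ) :
    #((W.powersetCard α).filter (a ∉ ·)) = (#W - 1).choose α := by
  rw [← card_erase_of_mem ha, ← card_powersetCard]
  congr 1
  ext C
  simp only [mem_filter, mem_powersetCard, subset_erase]
  tauto

theorem card_filter_mem {n : ℕ} (W : Finset (Fin n)) (a : Fin n) (ha : a ∈ W) (α : ℕ)
    (hα : 1 ≤ α) :
    #((W.powersetCard α).filter (a ∈ ·)) = (#W - 1).choose (α - 1) := by
  have h := card_filter_add_card_filter_not (s := W.powersetCard α) (fun C => a ∈ C)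
  rw [card_filter_notMem W a ha, card_powersetCard] at h
  have hW : 0 < #W := card_pos.2 ⟨a, ha⟩
  obtain ⟨m, hm⟩ : ∃ m, #W = m + 1 := ⟨#W - 1, by omega⟩
  obtain ⟨β, rfl⟩ : ∃ β, α = β + 1 := ⟨α - 1, by omega⟩
  rw [hm, Nat.choose_succ_succ] at h
  rw [hm]
  simp only [Nat.add_sub_cancel] at h ⊢
  simp only [Nat.succ_eq_add_one] at h
  omega

theorem prod_three (i s p q t : ℕ) (h : i < s) :
    ∏ j : Fin s, (if (j : ℕ) < i then p else if (j : ℕ) = i then q else t) =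
      p ^ i * q * t ^ (s - (i + 1)) := by
  rw [Fin.prod_univ_eq_prod_range (fun j => if j < i then p else if j = i then q else t) s]
  obtain ⟨d, rfl⟩ : ∃ d, s = i + 1 + d := ⟨s - (i + 1), by omega⟩
  rw [prod_range_add, prod_range_succ]
  congr 1
  · congr 1
    · rw [prod_congr rfl (g := fun _ => p)]
      · simp
      · intro j hj
        rw [if_pos (mem_range.1 hj)]
    · simp
  · rw [prod_congr rfl (g := fun _ => t)]
    · simp
    · intro j _
      rw [if_neg (by omega), if_neg (by omega)]

namespace VPart
variable {n s : ℕ}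

theorem aw_eq_iff {x y : VPart n s} {B : Finset (Fin n)} {k : Fin n}
    (h : IsSplit x y B (y.P.part k)) (hmin : ∀ a ∈ B, k ≤ a) (i : Fin s) :
    atomWord y i k = atomWord x i k ↔ atomWord x i k ∈ y.w i (y.P.part k) := by
  have hx := aw_least x h.hB (h.hCB (mem_part' y k)) hmin i
  have hy := aw_least y h.C_mem (mem_part' y k) (fun a ha => hmin a (h.hCB ha)) i
  constructor
  · intro he
    rw [← he]; exact hy.1
  · intro hm
    exact le_antisymm (hy.2 hm) (hx.2 (h.w1 i hy.1))

theorem FirstNS.char {x y : VPart n s} {k : Fin n} (h : FirstNS x k) (i : Fin s) :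
    (y ⋖ x ∧ lam (y : WithBot (VPart n s)) x = lblK x k i) ↔
      IsSplit x y (x.P.part k) (y.P.part k) ∧
        (∀ i' < i, atomWord x i' k ∈ y.w i' (y.P.part k)) ∧
        atomWord x i k ∉ y.w i (y.P.part k) := by
  constructor
  · rintro ⟨hxy, hl⟩
    obtain ⟨B, k1, hk1, hmin, hs⟩ := exists_isSplit_of_covBy hxy
    by_cases haw : atomWord y = atomWord x
    · exfalso
      have hkn : (k : ℕ) + 1 < n := by
        obtain ⟨a, ha, hne⟩ : ∃ a ∈ x.P.part k, a ≠ k :=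
          exists_mem_ne (by have := h.two; omega) k
        have h1 := lt_of_le_of_ne (h.least a ha) (Ne.symm hne)
        have := Fin.lt_def.1 h1
        have := a.2
        omega
      rw [lam_coe, if_pos haw, lblK, mkLbl_inj] at hl
      omega
    · obtain ⟨k2, i2, h1, h2, h3, h4⟩ := firstDiff_spec haw
      rw [lam_coe, if_neg haw, h1] at hl
      obtain ⟨rfl, rfl⟩ := lblK_inj hl
      have hkB : k2 ∈ B := by
        by_contra hcon
        exact h2 (aw_out hs hcon i2)
      obtain rfl : B = x.P.part k2 := (x.P.part_eq_of_mem hs.hB hkB).symm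
      obtain rfl : k1 = k2 := le_antisymm (hmin _ hkB) (h.least _ hk1)
      refine ⟨hs, fun i' hi' => (aw_eq_iff hs hmin i').1 (h4 i' hi'), fun hcon => ?_⟩
      exact h2 ((aw_eq_iff hs hmin i2).2 hcon)
  · rintro ⟨hs, ha, hb⟩
    refine ⟨hs.covBy, ?_⟩
    have hne : atomWord y i k ≠ atomWord x i k := fun he => hb ((aw_eq_iff hs h.least i).1 he)
    have haw : atomWord y ≠ atomWord x := fun he => hne (by rw [he])
    obtain ⟨k2, i2, h1, h2, h3, h4⟩ := firstDiff_spec haw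
    rw [lam_coe, if_neg haw, h1]
    have hkB : k2 ∈ x.P.part k := by
      by_contra hcon
      exact h2 (aw_out hs hcon i2)
    obtain rfl : k = k2 := by
      rcases (h.least _ hkB).eq_or_lt with he | hlt
      · exact he
      · exact absurd (h3 k hlt i) hne
    obtain rfl : i = i2 := by
      rcases lt_trichotomy i i2 with hlt | he | hlt
      · exact absurd (h4 i hlt) hne
      · exact he
      · exact absurd ((aw_eq_iff hs h.least i2).2 (ha i2 hlt)) h2
    rfl

/-- the induction statement -/
def StA (n s r : ℕ) : Prop := ∀ (x : VPart n s) (k : Fin n) (i : Fin s) (j : ℕ),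
  #x.P.parts + r = n → (∀ k' < k, #(x.P.part k') = 1) → (∀ a ∈ x.P.part k, k ≤ a) →
  (k : ℕ) + 1 < n → j ≤ (atomWord x i k : ℕ) →
  cv n s (r + 1) x (mkLbl ((k : ℕ) + 1) ((i : ℕ) + 1) (j + 1)) =
    gF s #(x.P.part k) (i + 1) * ∏ B ∈ x.P.parts.erase (x.P.part k), gF s #B 1

/-- admissible label families -/
def fam (x : VPart n s) (k : Fin n) (i : Fin s) (α : ℕ) (i' : Fin s) : Finset (Finset (Fin n)) :=
  if (i' : ℕ) < i then ((x.w i' (x.P.part k)).powersetCard α).filter (atomWord x i' k ∈ ·)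
  else if (i' : ℕ) = i then ((x.w i' (x.P.part k)).powersetCard α).filter (atomWord x i' k ∉ ·)
  else (x.w i' (x.P.part k)).powersetCard α

theorem card_fam {x : VPart n s} {k : Fin n} (h : FirstNS x k) (i : Fin s) (α : ℕ) (hα : 1 ≤ α)
    (i' : Fin s) : #(fam x k i α i') =
      if (i' : ℕ) < i then (#(x.P.part k) - 1).choose (α - 1)
      else if (i' : ℕ) = i then (#(x.P.part k) - 1).choose α
      else (#(x.P.part k)).choose α := by
  have hl := aw_least x (part_mem' x k) (mem_part' x k) h.least i'
  have hc := x.card_w i' _ (part_mem' x k)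
  unfold fam
  split_ifs
  · rw [card_filter_mem _ _ hl.1 _ hα, hc]
  · rw [card_filter_notMem _ _ hl.1, hc]
  · rw [card_powersetCard, hc]

theorem fam_mem {x : VPart n s} {k : Fin n} {i : Fin s} {α : ℕ} {U : Fin s → Finset (Fin n)} :
    (∀ i', U i' ∈ fam x k i α i') ↔
      (∀ i', U i' ⊆ x.w i' (x.P.part k) ∧ #(U i') = α) ∧
      (∀ i' < i, atomWord x i' k ∈ U i') ∧ atomWord x i k ∉ U i := by
  constructor
  · intro hU
    refine ⟨fun i' => ?_, fun i' hi' => ?_, ?_⟩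
    · have := hU i'
      unfold fam at this
      split_ifs at this
      · exact mem_powersetCard.1 (mem_filter.1 this).1
      · exact mem_powersetCard.1 (mem_filter.1 this).1
      · exact mem_powersetCard.1 this
    · have := hU i'
      unfold fam at this
      rw [if_pos (Fin.lt_def.1 hi')] at this
      exact (mem_filter.1 this).2
    · have := hU i
      unfold fam at this
      rw [if_neg (lt_irrefl _), if_pos rfl] at this
      exact (mem_filter.1 this).2
  · rintro ⟨h1, h2, h3⟩ i'
    unfold fam
    split_ifs with ha hb
    · exact mem_filter.2 ⟨mem_powersetCard.2 (h1 i'), h2 i' (Fin.lt_def.2 ha)⟩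
    · obtain rfl : i' = i := Fin.ext hb
      exact mem_filter.2 ⟨mem_powersetCard.2 (h1 _), h3⟩
    · exact mem_powersetCard.2 (h1 i')

theorem sum_subsets (B : Finset (Fin n)) (k : Fin n) (hk : k ∈ B) (G : ℕ → ℕ) :
    ∑ C ∈ B.powerset.filter (fun C => k ∈ C ∧ C ≠ B), G #C =
      ∑ α ∈ Icc 1 (#B - 1), (#B - 1).choose (α - 1) * G α := by
  have hmaps : ∀ C ∈ B.powerset.filter (fun C => k ∈ C ∧ C ≠ B), #C ∈ Icc 1 (#B - 1) := by
    intro C hC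
    simp only [mem_filter, mem_powerset] at hC
    have h1 : 0 < #C := card_pos.2 ⟨k, hC.2.1⟩
    have h2 := card_lt_card (ssubset_of_subset_of_ne hC.1 hC.2.2)
    rw [mem_Icc]; omega
  rw [← sum_fiberwise_of_maps_to hmaps]
  refine sum_congr rfl fun α hα => ?_
  rw [mem_Icc] at hα
  rw [sum_congr rfl (g := fun _ => G α)
    (fun C hC => by rw [(mem_filter.1 hC).2]), sum_const, smul_eq_mul]
  congr 1
  rw [← card_filter_mem B k hk α hα.1]
  congr 1
  ext C
  simp only [mem_filter, mem_powerset, mem_powersetCard]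
  constructor
  · rintro ⟨⟨h1, h2, h3⟩, h4⟩
    exact ⟨⟨h1, h4⟩, h2⟩
  · rintro ⟨⟨h1, h4⟩, h2⟩
    refine ⟨⟨h1, h2, ?_⟩, h4⟩
    rintro rfl
    omega

theorem Ev_eq (r : ℕ) (hA : StA n s r) (x : VPart n s) (k : Fin n) (h : FirstNS x k)
    (hr : #x.P.parts + (r + 1) = n) (i : Fin s) :
    Ev (r + 1) x k i =
      bF s #(x.P.part k) (i + 1) * ∏ B ∈ x.P.parts.erase (x.P.part k), gF s #B 1 := by
  classical
  set B := x.P.part k with hBdef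
  set R := ∏ B' ∈ x.P.parts.erase B, gF s #B' 1 with hR
  have hkB : k ∈ B := mem_part' x k
  let T : Finset ((_ : Finset (Fin n)) × (Fin s → Finset (Fin n))) :=
    (B.powerset.filter (fun C => k ∈ C ∧ C ≠ B)).sigma
      (fun C => Fintype.piFinset (fam x k i #C))
  have hT : ∀ p, p ∈ T ↔ (p.1 ⊆ B ∧ k ∈ p.1 ∧ p.1 ≠ B) ∧ ∀ i', p.2 i' ∈ fam x k i #p.1 i' := by
    intro p
    simp [T, mem_sigma, mem_filter, mem_powerset, Fintype.mem_piFinset]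
  have step1 : Ev (r + 1) x k i =
      ∑ p ∈ T, gF s #p.1 (i + 1) * (gF s (#B - #p.1) 1 * R) := by
    unfold Ev
    refine sum_nbij (fun y : VPart n s => ⟨y.P.part k, fun i' => y.w i' (y.P.part k)⟩) ?_ ?_ ?_ ?_
    · intro y hy
      obtain ⟨hs, h1, h2⟩ := (h.char i).1 (mem_filter.1 hy).2
      rw [hT]
      refine ⟨⟨hs.hCB, mem_part' y k, hs.hne⟩, fam_mem.2 ⟨fun i' => ⟨hs.w1 i', ?_⟩, h1, h2⟩⟩
      exact y.card_w i' _ hs.C_mem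
    · intro y hy z hz hyz
      obtain ⟨hs, -⟩ := (h.char i).1 (mem_filter.1 hy).2
      obtain ⟨hs', -⟩ := (h.char i).1 (mem_filter.1 hz).2
      simp only [Sigma.mk.injEq, heq_eq_eq] at hyz
      rw [← hyz.1] at hs'
      refine hs.ext_of hs' fun i' => ?_
      have := congrFun hyz.2 i'
      rw [this, hyz.1]
    · intro p hp
      obtain ⟨⟨h1, h2, h3⟩, h4⟩ := (hT p).1 hp
      obtain ⟨h5, h6, h7⟩ := fam_mem.1 h4
      obtain ⟨y, hy, hyw⟩ := exists_split x (part_mem' x k) h1 h3 ⟨k, h2⟩ p.2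
        (fun i' => (h5 i').1) (fun i' => (h5 i').2)
      have hpk : y.P.part k = p.1 := y.P.part_eq_of_mem hy.C_mem h2
      refine ⟨y, ?_, ?_⟩
      · rw [mem_coe, mem_filter]
        refine ⟨mem_univ _, (h.char i).2 ?_⟩
        rw [hpk]
        refine ⟨hy, fun i' hi' => ?_, ?_⟩
        · rw [hyw]; exact h6 i' hi'
        · rw [hyw]; exact h7
      · obtain ⟨p1, p2⟩ := p
        simp only at hpk hyw
        simp only [hpk]
        congr 1
        funext i'
        exact hyw i'
    · intro y hy
      obtain ⟨hs, h1, h2⟩ := (h.char i).1 (mem_filter.1 hy).2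
      have hc := hs.card_parts
      have hC1 : ∀ a ∈ y.P.part k, k ≤ a := fun a ha => h.least a (hs.hCB ha)
      have hkn : (k : ℕ) + 1 < n := by
        obtain ⟨a, ha⟩ := hs.sdiff_nonempty
        have h3 := h.least a (mem_sdiff.1 ha).1
        have h4 : a ≠ k := by
          rintro rfl
          exact (mem_sdiff.1 ha).2 (mem_part' y a)
        have := Fin.lt_def.1 (lt_of_le_of_ne h3 (Ne.symm h4))
        have := a.2
        omega
      have hsing : ∀ k' < k, #(y.P.part k') = 1 := by
        intro k' hk'
        have h3 := h.one k' hk'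
        have h4 : x.P.part k' ≠ x.P.part k := by
          intro he
          rw [he] at h3
          have := h.two
          omega
        have h5 : x.P.part k' ∈ y.P.parts :=
          hs.mem_parts.2 (Or.inr (Or.inr ⟨h4, part_mem' x k'⟩))
        rw [y.P.part_eq_of_mem h5 (mem_part' x k'), h3]
      have hx := aw_least x hs.hB (mem_part' x k) h.least i
      have hy' := aw_least y hs.C_mem (mem_part' y k) hC1 i
      have hj : (atomWord x i k : ℕ) ≤ (atomWord y i k : ℕ) :=
        Fin.le_def.1 (hx.2 (hs.w1 i hy'.1))
      have := hA y k i (atomWord x i k : ℕ) (by omega) hsing hC1 hkn hj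
      rw [lblK, this, hs.erase_C, prod_insert, card_sdiff_of_subset hs.hCB]
      exact fun h' => hs.D_notMem (mem_of_mem_erase h')
  rw [step1, sum_sigma]
  have step2 : ∀ C ∈ B.powerset.filter (fun C => k ∈ C ∧ C ≠ B),
      (∑ U ∈ Fintype.piFinset (fam x k i #C), gF s #C (i + 1) * (gF s (#B - #C) 1 * R)) =
      (fun α => ((#B - 1).choose (α - 1) ^ (i : ℕ) * (#B - 1).choose α *
        (#B).choose α ^ (s - (i + 1))) * (gF s α (i + 1) * (gF s (#B - α) 1 * R))) #C := by
    intro C hC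
    have hC1 : 1 ≤ #C := card_pos.2 ⟨k, (mem_filter.1 hC).2.1⟩
    rw [sum_const, smul_eq_mul, Fintype.card_piFinset,
      prod_congr rfl (fun i' _ => card_fam h i #C hC1 i'), prod_three _ _ _ _ _ i.2]
  have key := sum_subsets B k hkB (fun α => ((#B - 1).choose (α - 1) ^ (i : ℕ) *
    (#B - 1).choose α * (#B).choose α ^ (s - (i + 1))) *
      (gF s α (i + 1) * (gF s (#B - α) 1 * R)))
  refine (sum_congr rfl step2).trans (Eq.trans ?_ (key.trans ?_))
  · congr!
  rw [bF, sum_mul]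
  refine sum_congr rfl fun α _ => ?_
  ring

end VPart
open Finset VPart

theorem sum_fin_Icc (s i : ℕ) (f : ℕ → ℕ) :
    (∑ j : Fin s, if i ≤ (j : ℕ) then f (j + 1) else 0) = ∑ j ∈ Icc (i + 1) s, f j := by
  rw [Fin.sum_univ_eq_sum_range (fun j => if i ≤ j then f (j + 1) else 0) s, ← sum_filter]
  refine sum_nbij' (fun j => j + 1) (fun j => j - 1) ?_ ?_ ?_ ?_ ?_
  · intro j hj
    simp only [mem_filter, mem_range, mem_Icc] at hj ⊢
    omega
  · intro j hj
    simp only [mem_filter, mem_range, mem_Icc] at hj ⊢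
    omega
  · intro j hj
    simp
  · intro j hj
    simp only [mem_Icc] at hj
    omega
  · intro j hj
    rfl

namespace VPart
variable {n s : ℕ}

theorem atomic_of_card {x : VPart n s} (h : #x.P.parts = n) : x.IsAtomic := by
  have h1 := x.P.sum_card_parts
  have h2 : ∑ B ∈ x.P.parts, 1 = ∑ B ∈ x.P.parts, #B := by
    rw [h1]; simp [h]
  have h3 := (sum_eq_sum_iff_of_le (fun B hB =>
    card_pos.2 (x.P.nonempty_of_mem_parts hB))).1 h2
  exact fun B hB => (h3 B hB).symm

theorem atomIndex_pos {x : VPart n s} (h : x.IsAtomic) : 1 ≤ atomIndex x := by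
  unfold atomIndex
  have : 0 < Nat.card {a' : VPart n s // a'.IsAtomic ∧ wordLe (atomWord a') (atomWord x)} := by
    rw [Nat.card_pos_iff]
    exact ⟨⟨⟨x, h, Or.inr rfl⟩⟩, inferInstance⟩
  omega

theorem stA (r : ℕ) : StA n s r := by
  induction r with
  | zero =>
    intro x k i j hr _ _ hkn _
    have hat : x.IsAtomic := atomic_of_card (by omega)
    have hidx := atomIndex_pos hat
    rw [cv_succ, if_pos, sum_eq_zero, hat _ (part_mem' x k), gF_one, prod_eq_one]
    · simp [cv, cnt]
    · intro B hB
      rw [hat B (mem_of_mem_erase hB), gF_one]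
    · intro y _
      simp [cv, cnt]
    · refine ⟨bot_covBy_iff.2 hat, ?_⟩
      rw [lam_bot, mkLbl_le]
      have := i.2
      omega
  | succ r ih =>
    intro x k i j hr hk1 hk2 hkn hj
    have hna : ¬ x.IsAtomic := fun h => by
      have := card_parts_eq_of_atomic h
      omega
    obtain ⟨k0, h0⟩ := exists_firstNS hna
    rw [cv_succ, if_neg (fun h => hna (bot_covBy_iff.1 h.1)), zero_add]
    have hsum := h0.sum_Q (r + 1) (fun l => mkLbl ((k : ℕ) + 1) ((i : ℕ) + 1) (j + 1) ≤ l)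
    refine Eq.trans (Eq.trans (by congr!) hsum) ?_
    rw [sum_congr rfl (fun i' _ => by rw [Ev_eq r ih x k0 h0 hr i'])]
    rcases lt_trichotomy k k0 with hlt | rfl | hgt
    · have hall : ∀ i' : Fin s, mkLbl ((k : ℕ) + 1) ((i : ℕ) + 1) (j + 1) ≤ lblK x k0 i' := by
        intro i'
        rw [lblK, mkLbl_le]
        have := Fin.lt_def.1 hlt
        omega
      simp only [hall, if_true]
      rw [← sum_mul]
      have h1 := sum_fin_Icc s 0 (fun t => bF s #(x.P.part k0) t)
      simp only [Nat.zero_le, if_true, zero_add] at h1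
      rw [h1, ← gF_two s 1 h0.two, mul_prod_erase _ (fun B => gF s #B 1) (part_mem' x k0),
        ← mul_prod_erase _ (fun B => gF s #B 1) (part_mem' x k), h0.one k hlt, gF_one, gF_one]
    · have hall : ∀ i' : Fin s, mkLbl ((k : ℕ) + 1) ((i : ℕ) + 1) (j + 1) ≤ lblK x k i' ↔
          (i : ℕ) ≤ (i' : ℕ) := by
        intro i'
        rw [lblK, mkLbl_le]
        constructor
        · intro h; omega
        · intro h
          rcases h.eq_or_lt with he | hl
          · obtain rfl : i = i' := Fin.ext he
            omega
          · omega
      simp only [hall]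
      rw [gF_two s _ h0.two, ← sum_fin_Icc, sum_mul]
      refine sum_congr rfl fun i' _ => ?_
      split_ifs <;> simp
    · exfalso
      have := hk1 k0 hgt
      have := h0.two
      omega

/-- the top element -/
def xtop (m s : ℕ) : VPart (m + 1) s where
  P := Finpartition.indiscrete (a := (univ : Finset (Fin (m + 1)))) univ_nonempty.ne_empty
  w := fun _ B => if B = univ then univ else ∅
  card_w := by
    intro i B hB
    have : B = univ := by simpa [Finpartition.indiscrete] using hB
    simp [this]
  part_w := by
    intro i a
    refine ⟨univ, ⟨by simp [Finpartition.indiscrete], by simp⟩, ?_⟩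
    rintro B ⟨hB, -⟩
    simpa [Finpartition.indiscrete] using hB
  w_junk := by
    intro i B hB
    have : B ≠ univ := by simpa [Finpartition.indiscrete] using hB
    simp [this]

theorem xtop_parts (m s : ℕ) : (xtop m s).P.parts = {univ} := rfl

theorem xtop_part (m s : ℕ) (k : Fin (m + 1)) : (xtop m s).P.part k = univ := by
  have := part_mem' (xtop m s) k
  rw [xtop_parts, mem_singleton] at this
  exact this

theorem le_xtop {m s : ℕ} (x : VPart (m + 1) s) : x ≤ xtop m s := by
  refine ⟨fun B hB => ⟨univ, by simp [xtop_parts], subset_univ B⟩, fun i B hB B' hB' _ => ?_⟩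
  rw [xtop_parts, mem_singleton] at hB'
  have : (xtop m s).w i B' = univ := by
    change (if B' = univ then univ else ∅) = univ
    rw [if_pos hB']
  rw [this]
  exact subset_univ _

theorem isTop_iff {m s : ℕ} (c : WithBot (VPart (m + 1) s)) : IsTop c ↔ c = xtop m s := by
  have ht : IsTop (xtop m s : WithBot (VPart (m + 1) s)) := by
    intro b
    induction b using WithBot.recBotCoe with
    | bot => exact bot_le
    | coe b => exact WithBot.coe_le_coe.2 (le_xtop b)
  constructor
  · intro h
    exact le_antisymm (ht c) (h _)
  · rintro rfl
    exact ht

open scoped Classical in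
theorem card_DecChain (m s : ℕ) (Q : Lbl → Prop) :
    Nat.card {c : DecChain (m + 1) s //
      Q (lam (c.1 (Fin.last m).castSucc) (c.1 (Fin.last (m + 1))))} =
    (if (⊥ : WithBot (VPart (m + 1) s)) ⋖ xtop m s ∧
        Q (lam (⊥ : WithBot (VPart (m + 1) s)) (xtop m s))
      then cv (m + 1) s m ⊥ (lam (⊥ : WithBot (VPart (m + 1) s)) (xtop m s)) else 0) +
    ∑ y : VPart (m + 1) s, if y ⋖ xtop m s ∧ Q (lam (y : WithBot (VPart (m + 1) s)) (xtop m s))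
      then cv (m + 1) s m y (lam (y : WithBot (VPart (m + 1) s)) (xtop m s)) else 0 := by
  have h1 := card_chainsQ (fun a b : WithBot (VPart (m + 1) s) => a ⋖ b) lam ⊥ m (xtop m s)
    (fun y => Q (lam y (xtop m s)))
  rw [sum_withBot] at h1
  simp only [WithBot.coe_covBy_coe] at h1
  refine Eq.trans ?_ (h1.trans ?_)
  · unfold DecChain
    rw [Nat.card_congr (Equiv.subtypeSubtypeEquivSubtypeInter _
      (fun c : Fin (m + 1 + 1) → WithBot (VPart (m + 1) s) =>
        Q (lam (c (Fin.last m).castSucc) (c (Fin.last (m + 1))))))]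
    refine Nat.card_congr (Equiv.subtypeEquivRight fun c => ?_)
    rw [isTop_iff]
    unfold ChP
    refine and_congr_right fun hc => ?_
    rw [hc.2.1]
  · unfold cv
    congr!

theorem xtop_firstNS (m s : ℕ) (hm : 1 ≤ m) : FirstNS (xtop m s) 0 where
  two := by rw [xtop_part]; simp; omega
  one := by intro k hk; exact absurd hk (Fin.not_lt_zero k)

open scoped Classical in
theorem card_DecChain_two (r s : ℕ) (Q : Lbl → Prop) :
    Nat.card {c : DecChain (r + 2) s //
      Q (lam (c.1 (Fin.last (r + 1)).castSucc) (c.1 (Fin.last (r + 2))))} =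
    ∑ i : Fin s, if Q (lblK (xtop (r + 1) s) 0 i) then bF s (r + 2) (i + 1) else 0 := by
  have h0 := xtop_firstNS (r + 1) s (by omega)
  rw [card_DecChain, if_neg (fun h => h0.not_atomic (bot_covBy_iff.1 h.1)), zero_add, h0.sum_Q]
  refine sum_congr rfl fun i _ => ?_
  rw [Ev_eq r (stA r) _ _ h0 (by rw [xtop_parts, card_singleton]; omega)]
  simp only [xtop_part, xtop_parts, erase_singleton, prod_empty, mul_one, card_univ,
    Fintype.card_fin]

theorem Bt_eq (m s : ℕ) (hm : 1 ≤ m) : Bt m s = gF s m 1 := by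
  have e : ∀ m, Bt (m + 1) s = Nat.card {c : DecChain (m + 1) s //
      (fun _ : Lbl => True) (lam (c.1 (Fin.last m).castSucc) (c.1 (Fin.last (m + 1))))} :=
    fun m => Nat.card_congr (Equiv.subtypeUnivEquiv (fun _ => trivial)).symm
  obtain ⟨m, rfl⟩ : ∃ t, m = t + 1 := ⟨m - 1, by omega⟩
  rcases m with _ | r
  · refine ((e 0).trans (card_DecChain 0 s (fun _ => True))).trans ?_
    rw [if_pos, sum_eq_zero, gF_one]
    · simp [cv, cnt]
    · intro y _
      simp [cv, cnt]
    · refine ⟨bot_covBy_iff.2 ?_, trivial⟩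
      apply atomic_of_card
      rw [xtop_parts, card_singleton]
  · refine ((e (r + 1)).trans (card_DecChain_two r s (fun _ => True))).trans ?_
    rw [gF_two s _ (by omega)]
    have h1 := sum_fin_Icc s 0 (fun t => bF s (r + 2) t)
    simp only [Nat.zero_le, if_true, zero_add] at h1
    simp only [if_true]
    exact h1

theorem Bti_eq (m s i : ℕ) (hm : 2 ≤ m) (hi : 1 ≤ i) (his : i ≤ s) : Bti m s i = bF s m i := by
  obtain ⟨r, rfl⟩ : ∃ t, m = t + 2 := ⟨m - 2, by omega⟩
  have e : Bti (r + 2) s i = Nat.card {c : DecChain (r + 2) s //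
      (fun l : Lbl => (ofLex (ofLex l).2).1 = (i : ℤ))
        (lam (c.1 (Fin.last (r + 1)).castSucc) (c.1 (Fin.last (r + 2))))} := rfl
  refine (e.trans (card_DecChain_two r s
    (fun l : Lbl => (ofLex (ofLex l).2).1 = (i : ℤ)))).trans ?_
  rw [sum_eq_single ⟨i - 1, by omega⟩]
  · rw [if_pos]
    · congr 1
      simp only
      omega
    · change (((i - 1 : ℕ) : ℤ) + 1) = i
      omega
  · intro j _ hj
    rw [if_neg]
    intro h
    change (((j : ℕ) : ℤ) + 1) = i at h
    apply hj
    apply Fin.ext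
    simp only
    omega
  · simp

end VPart

/-- the recursion for the number of decreasing maximal chains. -/
theorem statement14 (n s : ℕ) (hn : 2 ≤ n) (i : ℕ) (hi1 : 1 ≤ i) (his : i ≤ s) :
    Bti n s i = ∑ α ∈ Finset.Icc 1 (n - 1),
      (if α = 1 then Bt 1 s else ∑ i' ∈ Finset.Icc i s, Bti α s i') * Bt (n - α) s *
        (n - 1).choose (α - 1) ^ i * (n - 1).choose α * n.choose α ^ (s - i) := by
  rw [Bti_eq n s i hn hi1 his, bF]
  refine sum_congr rfl fun α hα => ?_
  rw [mem_Icc] at hα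
  have h1 : (if α = 1 then Bt 1 s else ∑ i' ∈ Finset.Icc i s, Bti α s i') = gF s α i := by
    split_ifs with h
    · rw [Bt_eq 1 s le_rfl, h, gF_one, gF_one]
    · rw [gF_two s i (by omega)]
      refine sum_congr rfl fun i' hi' => ?_
      rw [mem_Icc] at hi'
      exact Bti_eq α s i' (by omega) (by omega) hi'.2
  rw [h1, Bt_eq (n - α) s (by omega)]
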